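/- For positive integers a₁ ≥ a₂ ≥ a₃ ≥ a₄, the complete 4-partite graph K_{a₁,a₂,a₃,a₄} is NIC-planar if and only if (a₁ ≤ 4 and a₂ = 1), or (a₁ = a₂ = 2 and a₃ = 1). -/

import Mathlib

open Set

/-- Two subsets of the plane *properly cross* at a point `p`: in some open
neighbourhood of `p` the pair of sets looks, up to homeomorphism, like the two
coordinate axes meeting at the origin. -/
def ProperCross (A₁ A₂ : Set (ℝ × ℝ)) (p : ℝ × ℝ) : Prop :=
  ∃ U : Set (ℝ × ℝ), IsOpen U ∧ ∃ hp : p ∈ U, ∃ φ : U ≃ₜ (ℝ × ℝ),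
    φ ⟨p, hp⟩ = (0, 0) ∧
    (fun x => φ x) '' {x : U | (x : ℝ × ℝ) ∈ A₁} = {q : ℝ × ℝ | q.2 = 0} ∧
    (fun x => φ x) '' {x : U | (x : ℝ × ℝ) ∈ A₂} = {q : ℝ × ℝ | q.1 = 0}

/-- A drawing of a simple graph `G` in the plane: vertices go to distinct points,
each edge is drawn as a continuous injective arc joining the points of its two
endpoints, no arc passes through the point of a vertex other than its endpoints,
arcs of edges sharing an endpoint meet only at that common point, any two arcs
meet in finitely many points, every intersection point of two arcs that is not a
common endpoint is a proper crossing, and no point of the plane that is not a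
vertex point lies on more than two arcs. -/
structure Drawing {V : Type*} (G : SimpleGraph V) where
  pos : V → ℝ × ℝ
  pos_inj : Function.Injective pos
  arc : G.edgeSet → ℝ → ℝ × ℝ
  arc_cont : ∀ e, ContinuousOn (arc e) (Icc 0 1)
  arc_inj : ∀ e, InjOn (arc e) (Icc 0 1)
  arc_ends : ∀ e : G.edgeSet, ∃ u v : V, (e : Sym2 V) = s(u, v) ∧
    arc e 0 = pos u ∧ arc e 1 = pos v
  no_vertex_interior : ∀ (e : G.edgeSet) (v : V), v ∉ (e : Sym2 V) →
    pos v ∉ arc e '' Icc 0 1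
  shared_endpoint : ∀ e₁ e₂ : G.edgeSet, e₁ ≠ e₂ → ∀ v : V,
    v ∈ (e₁ : Sym2 V) → v ∈ (e₂ : Sym2 V) →
    arc e₁ '' Icc 0 1 ∩ arc e₂ '' Icc 0 1 ⊆ {pos v}
  finite_meet : ∀ e₁ e₂ : G.edgeSet, e₁ ≠ e₂ →
    (arc e₁ '' Icc 0 1 ∩ arc e₂ '' Icc 0 1).Finite
  proper : ∀ e₁ e₂ : G.edgeSet, e₁ ≠ e₂ →
    ∀ p ∈ arc e₁ '' Icc 0 1 ∩ arc e₂ '' Icc 0 1, p ∉ Set.range pos →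
    ProperCross (arc e₁ '' Icc 0 1) (arc e₂ '' Icc 0 1) p
  at_most_two : ∀ p : ℝ × ℝ, p ∉ Set.range pos →
    ∀ e₁ e₂ e₃ : G.edgeSet, p ∈ arc e₁ '' Icc 0 1 → p ∈ arc e₂ '' Icc 0 1 →
      p ∈ arc e₃ '' Icc 0 1 → e₁ = e₂ ∨ e₁ = e₃ ∨ e₂ = e₃

namespace Drawing

variable {V : Type*} {G : SimpleGraph V}

/-- The image of the arc drawn for the edge `e`. -/
def arcIm (D : Drawing G) (e : G.edgeSet) : Set (ℝ × ℝ) :=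
  D.arc e '' Icc 0 1

/-- The set of crossings of the drawing: points that are not vertex points and
lie on (at least, hence exactly) two arcs.  (An intersection point of two arcs
that is a common endpoint of the two edges is a vertex point, and conversely a
vertex point on two arcs is a common endpoint, so these are precisely the
intersection points of pairs of arcs that are not common endpoints.) -/
def crossings (D : Drawing G) : Set (ℝ × ℝ) :=
  {p | p ∉ Set.range D.pos ∧ ∃ e₁ e₂ : G.edgeSet, e₁ ≠ e₂ ∧ p ∈ D.arcIm e₁ ∧ p ∈ D.arcIm e₂}

/-- The number of crossings of the drawing. -/
noncomputable def crossingCount (D : Drawing G) : ℕ := D.crossings.ncard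

/-- The cluster set `S(c)` of a crossing `c`: the set of end-vertices of the
(two) edges whose arcs pass through `c`. -/
def cluster (D : Drawing G) (c : ℝ × ℝ) : Set V :=
  {v | ∃ e : G.edgeSet, c ∈ D.arcIm e ∧ v ∈ (e : Sym2 V)}

/-- A drawing is 1-planar if each edge's arc is crossed at most once. -/
def IsOnePlanar (D : Drawing G) : Prop :=
  ∀ e : G.edgeSet, {p | p ∈ D.crossings ∧ p ∈ D.arcIm e}.Subsingleton

/-- A drawing is NIC-planar if it is 1-planar and the cluster sets of any two
distinct crossings share at most one vertex. -/
def IsNICPlanar (D : Drawing G) : Prop :=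
  D.IsOnePlanar ∧ ∀ c₁ ∈ D.crossings, ∀ c₂ ∈ D.crossings, c₁ ≠ c₂ →
    (D.cluster c₁ ∩ D.cluster c₂).ncard ≤ 1

/-- A drawing is IC-planar if it is 1-planar and the cluster sets of any two
distinct crossings are disjoint. -/
def IsICPlanar (D : Drawing G) : Prop :=
  D.IsOnePlanar ∧ ∀ c₁ ∈ D.crossings, ∀ c₂ ∈ D.crossings, c₁ ≠ c₂ →
    D.cluster c₁ ∩ D.cluster c₂ = ∅

end Drawing

/-- A graph is 1-planar if it admits a 1-planar drawing. -/
def SimpleGraph.OnePlanar {V : Type*} (G : SimpleGraph V) : Prop :=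
  ∃ D : Drawing G, D.IsOnePlanar

/-- A graph is NIC-planar if it admits an NIC-planar drawing. -/
def SimpleGraph.NICPlanar {V : Type*} (G : SimpleGraph V) : Prop :=
  ∃ D : Drawing G, D.IsNICPlanar

/-- A graph is IC-planar if it admits an IC-planar drawing. -/
def SimpleGraph.ICPlanar {V : Type*} (G : SimpleGraph V) : Prop :=
  ∃ D : Drawing G, D.IsICPlanar

/-- The crossing number of `G`: the minimum number of crossings over all
drawings of `G`. -/
noncomputable def SimpleGraph.crossingNumber {V : Type*} (G : SimpleGraph V) : ℕ :=
  sInf {n | ∃ D : Drawing G, D.crossingCount = n}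
/-- The graph `H` is a minimum non-NIC-planar graph: `H` is not NIC-planar but
deleting any single edge of `H` yields an NIC-planar graph. -/
def MinNonNICPlanar {V : Type*} (H : SimpleGraph V) : Prop :=
  ¬ H.NICPlanar ∧ ∀ e ∈ H.edgeSet, (H.deleteEdges {e}).NICPlanar

/-- The graph `H` is a minimum non-IC-planar graph: `H` is not IC-planar but
deleting any single edge of `H` yields an IC-planar graph. -/
def MinNonICPlanar {V : Type*} (H : SimpleGraph V) : Prop :=
  ¬ H.ICPlanar ∧ ∀ e ∈ H.edgeSet, (H.deleteEdges {e}).ICPlanar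

/-- The complete multipartite graph with parts of sizes `a 0, …, a (k-1)`. -/
abbrev completeMultipartite {k : ℕ} (a : Fin k → ℕ) :
    SimpleGraph (Σ i : Fin k, Fin (a i)) :=
  SimpleGraph.completeMultipartiteGraph fun i => Fin (a i)

/-- `G` contains a subgraph isomorphic to `H`, i.e. there is an injective graph
homomorphism from `H` to `G`. -/
def ContainsSubgraphIso {V W : Type*} (G : SimpleGraph V) (H : SimpleGraph W) : Prop :=
  ∃ f : H →g G, Function.Injective f

/-- The total variation over `[0, 1]` of a continuous logarithm of `f`. -/
noncomputable def logVariation (f : ℝ → ℂ) : ℂ :=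
  open Classical in
  if h : ∃ L : ℝ → ℂ, Continuous L ∧ ∀ t, Complex.exp (L t) = f t then
    h.choose 1 - h.choose 0
  else 0

theorem exists_continuous_log {A : Type*} [TopologicalSpace A] [SimplyConnectedSpace A]
    [LocallyPathConnectedSpace A] [Inhabited A] {f : A → ℂ} (hf : Continuous f)
    (h0 : ∀ x, f x ≠ 0) : ∃ L : A → ℂ, Continuous L ∧ ∀ x, Complex.exp (L x) = f x := by
  obtain ⟨F, ⟨-, hF⟩, -⟩ := Complex.isCoveringMapOn_exp.existsUnique_continuousMap_lifts
    ⟨f, hf⟩ (a₀ := default) (e₀ := Complex.log (f default)) (Complex.exp_log (h0 _)) h0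
  exact ⟨F, F.continuous, fun x => congrFun hF x⟩

theorem logVariation_eq {f L : ℝ → ℂ} (hL : Continuous L)
    (h : ∀ t, Complex.exp (L t) = f t) : logVariation f = L 1 - L 0 := by
  have hex : ∃ L : ℝ → ℂ, Continuous L ∧ ∀ t, Complex.exp (L t) = f t := ⟨L, hL, h⟩
  rw [logVariation, dif_pos hex]
  obtain ⟨hM, hMf⟩ := hex.choose_spec
  set M := hex.choose
  have hf : Continuous f := by
    rw [← funext h]
    fun_prop
  obtain ⟨F, -, hF⟩ := Complex.isCoveringMapOn_exp.existsUnique_continuousMap_lifts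
    ⟨f, hf⟩ (a₀ := (0 : ℝ)) (e₀ := L 0) (h 0) (fun t => by
      rw [ContinuousMap.coe_mk, ← h t]
      exact Complex.exp_ne_zero _)
  have h1 := hF ⟨L, hL⟩ ⟨rfl, funext h⟩
  have h2 := hF ⟨fun t => M t + (L 0 - M 0), by fun_prop⟩ ⟨by simp, funext fun t => by
    simp only [Function.comp_apply, ContinuousMap.coe_mk]
    rw [Complex.exp_add, Complex.exp_sub, h, hMf, hMf, div_self, mul_one]
    rw [← h 0]
    exact Complex.exp_ne_zero _⟩
  have h3 := DFunLike.congr_fun (h1.trans h2.symm) 1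
  simp only [ContinuousMap.coe_mk] at h3
  rw [h3]
  ring

theorem logVariation_eq_add_int {f : ℝ → ℂ} (hf : Continuous f) (h0 : ∀ t, f t ≠ 0) {z w : ℂ}
    (hz : Complex.exp z = f 0) (hw : Complex.exp w = f 1) :
    ∃ n : ℤ, logVariation f = w - z + n * (2 * Real.pi * Complex.I) := by
  obtain ⟨L, hL, hLf⟩ := exists_continuous_log hf h0
  rw [logVariation_eq hL hLf]
  obtain ⟨n, hn⟩ := Complex.exp_eq_exp_iff_exists_int.1 ((hLf 1).trans hw.symm)
  obtain ⟨m, hm⟩ := Complex.exp_eq_exp_iff_exists_int.1 ((hLf 0).trans hz.symm)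
  refine ⟨n - m, ?_⟩
  rw [hn, hm]
  push_cast
  ring

/-- For disjoint curves, the angles swept out by one curve as seen from the endpoints of the other
one differ by the same amount, whichever curve plays the role of the observer. -/
theorem logVariation_square {f g : ℝ → ℂ} (hf : Continuous f) (hg : Continuous g)
    (h : ∀ s t, f s ≠ g t) :
    logVariation (fun t => g t - f 1) - logVariation (fun t => g t - f 0) =
      logVariation (fun s => f s - g 1) - logVariation (fun s => f s - g 0) := by
  obtain ⟨L, hL, hLf⟩ := exists_continuous_log (A := ℝ × ℝ) (f := fun p => f p.1 - g p.2)
    (by fun_prop) (fun p => sub_ne_zero.2 (h _ _))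
  have h1 (t : ℝ) : logVariation (fun s => f s - g t) = L (1, t) - L (0, t) :=
    logVariation_eq (L := fun s => L (s, t)) (by fun_prop) (fun s => hLf (s, t))
  have h2 (s : ℝ) : logVariation (fun t => g t - f s) = L (s, 1) - L (s, 0) := by
    rw [logVariation_eq (L := fun t => L (s, t) + Real.pi * Complex.I) (by fun_prop) (fun t => by
      rw [Complex.exp_add, hLf (s, t), Complex.exp_pi_mul_I]
      ring)]
    ring
  rw [h1, h1, h2, h2]
  ring

theorem exists_log_sub_family {a : Fin 3 → ℂ} (ha : Function.Injective a) :
    ∃ ℓ : Fin 3 → Fin 3 → ℂ, (∀ i k, i ≠ k → Complex.exp (ℓ i k) = a k - a i) ∧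
      ∀ i k, i < k → ℓ k i = ℓ i k + Real.pi * Complex.I := by
  refine ⟨fun i k => if i < k then Complex.log (a k - a i)
    else Complex.log (a i - a k) + Real.pi * Complex.I, fun i k hik => ?_, fun i k hik => ?_⟩
  · have h1 : a k - a i ≠ 0 := sub_ne_zero.2 (ha.ne hik.symm)
    have h2 : a i - a k ≠ 0 := sub_ne_zero.2 (ha.ne hik)
    dsimp only
    split_ifs with h
    · exact Complex.exp_log h1
    · rw [Complex.exp_add, Complex.exp_log h2, Complex.exp_pi_mul_I]
      ring
  · simp [hik, hik.not_gt]

/-- The complete bipartite graph `K_{3,3}` cannot be mapped continuously to the plane in such a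
way that independent edges have disjoint images. -/
theorem not_forall_disjoint_of_K33 {a b : Fin 3 → ℂ} {γ : Fin 3 → Fin 3 → ℝ → ℂ}
    (hγ : ∀ i j, Continuous (γ i j)) (h0 : ∀ i j, γ i j 0 = a i) (h1 : ∀ i j, γ i j 1 = b j)
    (hd : ∀ i j k l, i ≠ k → j ≠ l → ∀ s t, γ i j s ≠ γ k l t) : False := by
  have ne (j : Fin 3) : ∃ l, j ≠ l := ⟨j + 1, by revert j; decide⟩
  have ha : Function.Injective a := fun i k hik => by
    by_contra hne
    apply hd i 0 k 1 hne (by decide) 0 0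
    rw [h0, h0, hik]
  have hb : Function.Injective b := fun j l hjl => by
    by_contra hne
    apply hd 0 j 1 l (by decide) hne 1 1
    rw [h1, h1, hjl]
  have hab (i j : Fin 3) : b j - a i ≠ 0 := by
    obtain ⟨k, hk⟩ := ne i
    obtain ⟨l, hl⟩ := ne j
    have := hd i l k j hk hl.symm 0 1
    rw [h0, h1] at this
    exact sub_ne_zero.2 this.symm
  obtain ⟨ℓa, hℓa, hℓa'⟩ := exists_log_sub_family ha
  obtain ⟨ℓb, hℓb, hℓb'⟩ := exists_log_sub_family hb
  set ℓ : Fin 3 → Fin 3 → ℂ := fun i j => Complex.log (b j - a i)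
  have hℓ (i j) : Complex.exp (ℓ i j) = b j - a i := Complex.exp_log (hab i j)
  have hℓ' (i j) : Complex.exp (ℓ i j + Real.pi * Complex.I) = a i - b j := by
    rw [Complex.exp_add, hℓ, Complex.exp_pi_mul_I]
    ring
  have hn (i k l : Fin 3) (hik : i ≠ k) : ∃ n : ℤ, logVariation (fun t => γ k l t - a i) =
      ℓ i l - ℓa i k + n * (2 * Real.pi * Complex.I) := by
    obtain ⟨j, hj⟩ := ne l
    have hc := hγ k l
    refine logVariation_eq_add_int (by fun_prop) (fun t => ?_) ?_ ?_
    · rw [← h0 i j]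
      exact sub_ne_zero.2 (hd k l i j hik.symm hj t 0)
    · rw [h0, hℓa i k hik]
    · rw [h1, hℓ]
  have hm (j k l : Fin 3) (hjl : j ≠ l) : ∃ m : ℤ, logVariation (fun t => γ k l t - b j) =
      ℓb j l - (ℓ k j + Real.pi * Complex.I) + m * (2 * Real.pi * Complex.I) := by
    obtain ⟨i, hi⟩ := ne k
    have hc := hγ k l
    refine logVariation_eq_add_int (by fun_prop) (fun t => ?_) ?_ ?_
    · rw [← h1 i j]
      exact sub_ne_zero.2 (hd k l i j hi hjl.symm t 1)
    · rw [h0, hℓ']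
    · rw [h1, hℓb j l hjl]
  choose! n hn using hn
  choose! m hm using hm
  have hπ : (2 * Real.pi * Complex.I : ℂ) ≠ 0 := Complex.two_pi_I_ne_zero
  have cell (i k j l : Fin 3) (hik : i < k) (hjl : j ≠ l) :
      m j k l - n i k l - (m l i j - n k i j) = if j < l then 1 else 0 := by
    have key := logVariation_square (hγ i j) (hγ k l) (hd i j k l hik.ne hjl)
    rw [h0, h1, h0, h1, hn i k l hik.ne, hm j k l hjl, hn k i j hik.ne', hm l i j hjl.symm,
      hℓa' i k hik] at key
    have : ((m j k l - n i k l - (m l i j - n k i j) : ℤ) : ℂ) * (2 * Real.pi * Complex.I) =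
        ((if j < l then 1 else 0 : ℤ) : ℂ) * (2 * Real.pi * Complex.I) := by
      split_ifs with h
      · rw [hℓb' j l h] at key
        push_cast
        linear_combination key
      · rw [hℓb' l j (lt_of_le_of_ne (not_lt.1 h) hjl.symm)] at key
        push_cast
        linear_combination key
    exact_mod_cast mul_right_cancel₀ hπ this
  have cell' (i k j l : Fin 3) (hik : i < k) (hjl : j < l) :
      m j k l - n i k l - (m l i j - n k i j) = 1 ∧
        m l k j - n i k j - (m j i l - n k i l) = 0 :=
    ⟨(cell i k j l hik hjl.ne).trans (if_pos hjl),
      (cell i k l j hik hjl.ne').trans (if_neg hjl.not_gt)⟩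
  have e (i k : Fin 3) (hik : i < k) :=
    And.intro (cell' i k 0 1 hik (by decide))
      (And.intro (cell' i k 0 2 hik (by decide)) (cell' i k 1 2 hik (by decide)))
  have e1 := e 0 1 (by decide)
  have e2 := e 0 2 (by decide)
  have e3 := e 1 2 (by decide)
  omega

/-- A topological form of the non-planarity of `K_{3,3}`: nine sets joining each of three points to
each of three other points cannot be disjoint for all pairs of independent edges. -/
theorem exists_inter_nonempty_of_K33 {a b : Fin 3 → ℝ × ℝ} {S : Fin 3 → Fin 3 → Set (ℝ × ℝ)}
    (h : ∀ i j, JoinedIn (S i j) (a i) (b j)) :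
    ∃ i j k l, i ≠ k ∧ j ≠ l ∧ (S i j ∩ S k l).Nonempty := by
  by_contra! hd
  choose γ hγ using h
  refine not_forall_disjoint_of_K33
    (γ := fun i j t => Complex.equivRealProdCLM.symm ((γ i j).extend t))
    (a := fun i => Complex.equivRealProdCLM.symm (a i))
    (b := fun i => Complex.equivRealProdCLM.symm (b i))
    (fun i j => by fun_prop) (by simp) (by simp) fun i j k l hik hjl s t hst => ?_
  have hmem (i j : Fin 3) (t : ℝ) : (γ i j).extend t ∈ S i j := by
    exact hγ i j (Set.projIcc 0 1 zero_le_one t)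
  have := Complex.equivRealProdCLM.symm.injective hst
  exact (Set.ext_iff.1 (hd i j k l hik hjl) _).1 ⟨hmem i j s, this ▸ hmem k l t⟩

namespace Drawing

variable {V : Type*} {G : SimpleGraph V}

/-- The image of the arc drawn for the edge `uv`, empty if `u` and `v` are not adjacent. -/
def edgeIm (D : Drawing G) (u v : V) : Set (ℝ × ℝ) :=
  {p | ∃ h : s(u, v) ∈ G.edgeSet, p ∈ D.arcIm ⟨s(u, v), h⟩}

/-- The arcs of the edges `uv` and `xy` have a point in common. -/
def Meet (D : Drawing G) (u v x y : V) : Prop :=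
  (D.edgeIm u v ∩ D.edgeIm x y).Nonempty

theorem Meet.symm {D : Drawing G} {u v x y : V} (h : D.Meet u v x y) : D.Meet x y u v := by
  rwa [Meet, Set.inter_comm]

theorem joinedIn_edgeIm (D : Drawing G) {u v : V} (h : G.Adj u v) :
    JoinedIn (D.edgeIm u v) (D.pos u) (D.pos v) := by
  have h' : s(u, v) ∈ G.edgeSet := h
  set e : G.edgeSet := ⟨s(u, v), h'⟩ with he
  have key : JoinedIn (D.arcIm e) (D.arc e 0) (D.arc e 1) :=
    ((convex_Icc (0 : ℝ) 1).isPathConnected ⟨0, by simp⟩ |>.image' (D.arc_cont e)).joinedIn _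
      (Set.mem_image_of_mem _ (by simp)) _ (Set.mem_image_of_mem _ (by simp))
  obtain ⟨x, y, hxy, h0, h1⟩ := D.arc_ends e
  rw [h0, h1] at key
  refine JoinedIn.mono (U := D.arcIm e) ?_ fun p hp => ⟨h', hp⟩
  rcases Sym2.eq_iff.1 hxy with ⟨rfl, rfl⟩ | ⟨rfl, rfl⟩
  · exact key
  · exact key.symm

theorem exists_meet_K33 (D : Drawing G) {a b : Fin 3 → V} (h : ∀ i j, G.Adj (a i) (b j)) :
    ∃ i j k l, i ≠ k ∧ j ≠ l ∧ D.Meet (a i) (b j) (a k) (b l) :=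
  exists_inter_nonempty_of_K33 fun i j => D.joinedIn_edgeIm (h i j)

/-- The version of `exists_meet_K33` in which the edge between `a 0` and `b 0` is subdivided by the
vertex `w`. -/
theorem exists_meet_K33_subdivided (D : Drawing G) {a b : Fin 3 → V} {w : V}
    (h : ∀ i j, (i, j) ≠ (0, 0) → G.Adj (a i) (b j)) (ha : G.Adj (a 0) w) (hb : G.Adj w (b 0)) :
    (∃ i j k l, i ≠ k ∧ j ≠ l ∧ (i, j) ≠ (0, 0) ∧ (k, l) ≠ (0, 0) ∧
      D.Meet (a i) (b j) (a k) (b l)) ∨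
    ∃ k l, k ≠ 0 ∧ l ≠ 0 ∧ (D.Meet (a 0) w (a k) (b l) ∨ D.Meet w (b 0) (a k) (b l)) := by
  obtain ⟨i, j, k, l, hik, hjl, p, hp, hp'⟩ := exists_inter_nonempty_of_K33
    (a := D.pos ∘ a) (b := D.pos ∘ b)
    (S := fun i j => if (i, j) = (0, 0) then D.edgeIm (a 0) w ∪ D.edgeIm w (b 0)
      else D.edgeIm (a i) (b j)) fun i j => by
    split_ifs with hij
    · obtain ⟨rfl, rfl⟩ := Prod.ext_iff.1 hij
      exact ((D.joinedIn_edgeIm ha).mono Set.subset_union_left).trans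
        ((D.joinedIn_edgeIm hb).mono Set.subset_union_right)
    · exact D.joinedIn_edgeIm (h i j hij)
  have aux (k l : Fin 3) (hk : k ≠ 0) (hl : l ≠ 0)
      (hp : p ∈ D.edgeIm (a 0) w ∪ D.edgeIm w (b 0)) (hp' : p ∈ D.edgeIm (a k) (b l)) :
      ∃ k l, k ≠ 0 ∧ l ≠ 0 ∧ (D.Meet (a 0) w (a k) (b l) ∨ D.Meet w (b 0) (a k) (b l)) :=
    ⟨k, l, hk, hl, hp.imp (fun h => ⟨p, h, hp'⟩) fun h => ⟨p, h, hp'⟩⟩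
  split_ifs at hp hp' with h1 h2 h2
  · simp only [Prod.mk.injEq] at h1 h2
    exact (hik (h1.1.trans h2.1.symm)).elim
  · simp only [Prod.mk.injEq] at h1
    exact .inr (aux k l (h1.1 ▸ hik.symm) (h1.2 ▸ hjl.symm) hp hp')
  · simp only [Prod.mk.injEq] at h2
    exact .inr (aux i j (h2.1 ▸ hik) (h2.2 ▸ hjl) hp' hp)
  · exact .inl ⟨i, j, k, l, hik, hjl, h1, h2, p, hp, hp'⟩

/-- In an NIC-planar drawing, two crossings whose cluster sets share two vertices involve the same
pair of edges. -/
theorem IsNICPlanar.eq_of_meet [Finite V] {D : Drawing G} (hD : D.IsNICPlanar)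
    {u v x y u' v' x' y' : V} (hd : ∀ w ∈ s(u, v), w ∉ s(x, y))
    (hd' : ∀ w ∈ s(u', v'), w ∉ s(x', y'))
    (h : D.Meet u v x y) (h' : D.Meet u' v' x' y') {w z : V} (hwz : w ≠ z)
    (hw : w ∈ s(u, v) ∨ w ∈ s(x, y)) (hw' : w ∈ s(u', v') ∨ w ∈ s(x', y'))
    (hz : z ∈ s(u, v) ∨ z ∈ s(x, y)) (hz' : z ∈ s(u', v') ∨ z ∈ s(x', y')) :
    s(u, v) = s(u', v') ∧ s(x, y) = s(x', y') ∨ s(u, v) = s(x', y') ∧ s(x, y) = s(u', v') := by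
  have aux {u v x y : V} (h : s(u, v) ∈ G.edgeSet) (h' : s(x, y) ∈ G.edgeSet)
      (hd : ∀ w ∈ s(u, v), w ∉ s(x, y))
      {p : ℝ × ℝ} (hp : p ∈ D.arcIm ⟨s(u, v), h⟩ ∩ D.arcIm ⟨s(x, y), h'⟩) :
      p ∈ D.crossings ∧ s(u, v) ≠ s(x, y) ∧
        ∀ w, w ∈ s(u, v) ∨ w ∈ s(x, y) → w ∈ D.cluster p := by
    have hne : s(u, v) ≠ s(x, y) := fun heq => hd u (by simp) (heq ▸ by simp)
    refine ⟨⟨?_, _, _, fun heq => hne (congrArg Subtype.val heq), hp.1, hp.2⟩, hne, ?_⟩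
    · rintro ⟨w, rfl⟩
      have h1 : w ∈ s(u, v) := by
        by_contra hw
        exact D.no_vertex_interior ⟨s(u, v), h⟩ w hw hp.1
      exact D.no_vertex_interior ⟨s(x, y), h'⟩ w (hd w h1) hp.2
    · rintro w (hw | hw)
      exacts [⟨_, hp.1, hw⟩, ⟨_, hp.2, hw⟩]
  obtain ⟨p, ⟨h1, hp1⟩, ⟨h2, hp2⟩⟩ := h
  obtain ⟨p', ⟨h1', hp1'⟩, ⟨h2', hp2'⟩⟩ := h'
  obtain ⟨hc, hne, hcl⟩ := aux h1 h2 hd ⟨hp1, hp2⟩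
  obtain ⟨hc', hne', hcl'⟩ := aux h1' h2' hd' ⟨hp1', hp2'⟩
  rcases eq_or_ne p p' with rfl | hpp
  · have e3 := D.at_most_two p hc.1 _ _ _ hp1 hp2 hp1'
    have e4 := D.at_most_two p hc.1 _ _ _ hp1 hp2 hp2'
    simp only [Subtype.mk.injEq] at e3 e4
    grind
  · have := hD.2 p hc p' hc' hpp
    rw [Set.ncard_le_one] at this
    exact (hwz (this w ⟨hcl w hw, hcl' w hw'⟩ z ⟨hcl z hz, hcl' z hz'⟩)).elim

end Drawing

open Drawing

section Bipartite

variable {V : Type*} [Finite V] {G : SimpleGraph V} {n : ℕ} {p : Fin 3 → V} {q : Fin n → V}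

/-- In a complete bipartite subgraph with a side of size three, two distinct crossings have
disjoint traces on the other side and distinct traces on the side of size three. -/
theorem trace_of_meet (D : Drawing G) (hD : D.IsNICPlanar) (hp : Function.Injective p)
    (hq : Function.Injective q) (hadj : ∀ i j, G.Adj (p i) (q j)) {i k i' k' : Fin 3}
    {j l j' l' : Fin n} (hik : i ≠ k) (hjl : j ≠ l) (hik' : i' ≠ k') (hjl' : j' ≠ l')
    (h : D.Meet (p i) (q j) (p k) (q l)) (h' : D.Meet (p i') (q j') (p k') (q l'))
    (hj : j ≠ j') (hj' : j ≠ l') :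
    l ≠ j' ∧ l ≠ l' ∧ ¬ (i = i' ∧ k = k') ∧ ¬ (i = k' ∧ k = i') := by
  have hpq (i j) : p i ≠ q j := (hadj i j).ne
  have hqp (i j) : q j ≠ p i := (hadj i j).ne'
  have key := @IsNICPlanar.eq_of_meet V G _ D hD _ _ _ _ _ _ _ _
    (by simp [hp.eq_iff, hq.eq_iff, hpq, hqp, hik, hjl])
    (by simp [hp.eq_iff, hq.eq_iff, hpq, hqp, hik', hjl']) h h'
  simp only [Sym2.eq_iff, Sym2.mem_iff, hp.eq_iff, hq.eq_iff, hpq, hqp, hj, hj', and_false,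
    false_and, or_false] at key
  have common : ∀ i k i' k' : Fin 3, i ≠ k → i' ≠ k' →
      ∃ t, (t = i ∨ t = k) ∧ (t = i' ∨ t = k') := by decide
  obtain ⟨t, ht, ht'⟩ := common i k i' k' hik hik'
  have side (m : Fin n) (hm : m = j ∨ m = l) (hm' : m = j' ∨ m = l') : False := by
    refine @key (p t) (q m) (hpq t m) ?_ ?_ ?_ ?_ <;>
      simpa [hp.eq_iff, hq.eq_iff, hpq, hqp]
  have both (hi : i = i' ∨ i = k') (hk : k = i' ∨ k = k') : False := by
    refine @key (p i) (p k) (hp.ne hik) ?_ ?_ ?_ ?_ <;>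
      simp [hp.eq_iff, hpq, hi, hk]
  refine ⟨fun e => side l (.inr rfl) (.inl e), fun e => side l (.inr rfl) (.inr e),
    fun e => both (.inl e.1) (.inr e.2), fun e => both (.inr e.1) (.inl e.2)⟩

theorem not_nicPlanar_of_K35 {q : Fin 5 → V} (hp : Function.Injective p)
    (hq : Function.Injective q) (hadj : ∀ i j, G.Adj (p i) (q j)) : ¬ G.NICPlanar := by
  rintro ⟨D, hD⟩
  have avoid (j j' : Fin 5) :
      ∃ b : Fin 3 → Fin 5, Function.Injective b ∧ ∀ m, j ≠ b m ∧ j' ≠ b m := by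
    obtain ⟨t, ht⟩ : ∃ t, j' ≠ j → j.succAbove t = j' := by
      by_cases hj : j' = j
      · exact ⟨0, fun h => (h hj).elim⟩
      · obtain ⟨t, ht⟩ := Fin.exists_succAbove_eq hj
        exact ⟨t, fun _ => ht⟩
    refine ⟨j.succAbove ∘ t.succAbove, Fin.succAbove_right_injective.comp
      Fin.succAbove_right_injective, fun m => ⟨(Fin.succAbove_ne _ _).symm, ?_⟩⟩
    by_cases hj : j' = j
    · rw [hj]
      exact (Fin.succAbove_ne _ _).symm
    · rw [← ht hj]
      exact Fin.succAbove_right_injective.ne (Fin.succAbove_ne _ _).symm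
  have step (j j' : Fin 5) : ∃ i m k l, i ≠ k ∧ m ≠ l ∧ (j ≠ m ∧ j ≠ l) ∧ (j' ≠ m ∧ j' ≠ l) ∧
      D.Meet (p i) (q m) (p k) (q l) := by
    obtain ⟨b, hb, hj⟩ := avoid j j'
    obtain ⟨i, m, k, l, hik, hml, h⟩ := D.exists_meet_K33 (b := q ∘ b) fun i j => hadj i _
    exact ⟨i, b m, k, b l, hik, hb.ne hml, ⟨(hj m).1, (hj l).1⟩, ⟨(hj m).2, (hj l).2⟩, h⟩
  obtain ⟨i, j, k, l, hik, hjl, -, -, h⟩ := step 0 0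
  obtain ⟨i', j', k', l', hik', hjl', hj, -, h'⟩ := step j j
  obtain ⟨i'', j'', k'', l'', hik'', hjl'', hj', hj'', h''⟩ := step j j'
  obtain ⟨h1, h2, -⟩ := trace_of_meet D hD hp hq hadj hik hjl hik' hjl' h h' hj.1 hj.2
  obtain ⟨h3, h4, -⟩ := trace_of_meet D hD hp hq hadj hik hjl hik'' hjl'' h h'' hj'.1 hj'.2
  obtain ⟨h5, h6, -⟩ := trace_of_meet D hD hp hq hadj hik' hjl' hik'' hjl'' h' h'' hj''.1 hj''.2
  have hcard : ({j, l, j', l', j'', l''} : Finset (Fin 5)).card = 6 := by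
    simp [Finset.card_insert_of_notMem, *]
  exact absurd (hcard ▸ Finset.card_le_univ _) (by decide)

set_option synthInstance.maxHeartbeats 200000 in
set_option synthInstance.maxSize 1000 in
set_option maxHeartbeats 1000000 in
/-- The decisive configuration: two crossings that between them use all seven vertices. -/
theorem not_meet_and_meet {q : Fin 4 → V} (D : Drawing G) (hD : D.IsNICPlanar)
    (hp : Function.Injective p)
    (hq : Function.Injective q) (hadj : ∀ i j, G.Adj (p i) (q j))
    (hq' : G.Adj (q 0) (q 3) ∨ G.Adj (q 1) (q 3)) (h₁ : D.Meet (p 0) (q 0) (p 1) (q 1))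
    (h₂ : D.Meet (p 0) (q 2) (p 2) (q 3)) : False := by
  set f : Fin 3 ⊕ Fin 4 → V := Sum.elim p q with hf
  have hfinj : Function.Injective f := hp.sumElim hq fun i j => (hadj i j).ne
  have hmem (w u v : Fin 3 ⊕ Fin 4) : f w ∈ s(f u, f v) ↔ w ∈ s(u, v) := by
    simp [hfinj.eq_iff]
  have heq (a b c d : Fin 3 ⊕ Fin 4) : s(f a, f b) = s(f c, f d) ↔ s(a, b) = s(c, d) := by
    simp [hfinj.eq_iff]
  have transfer (u v x y u' v' x' y' : Fin 3 ⊕ Fin 4) (hd' : ∀ w ∈ s(u', v'), w ∉ s(x', y'))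
      (h' : D.Meet (f u') (f v') (f x') (f y')) (hd : ∀ w ∈ s(u, v), w ∉ s(x, y))
      (h : D.Meet (f u) (f v) (f x) (f y))
      (hcard : 1 < (({u, v, x, y} : Finset (Fin 3 ⊕ Fin 4)) ∩ {u', v', x', y'}).card) :
      s(s(u, v), s(x, y)) = s(s(u', v'), s(x', y')) := by
    obtain ⟨w, hw, z, hz, hwz⟩ := Finset.one_lt_card.1 hcard
    simp only [Finset.mem_inter, Finset.mem_insert, Finset.mem_singleton] at hw hz
    rw [Sym2.eq_iff]
    simp only [← heq]
    refine hD.eq_of_meet ?_ ?_ h h' (hfinj.ne hwz) ?_ ?_ ?_ ?_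
    · simpa [hfinj.eq_iff] using hd
    · simpa [hfinj.eq_iff] using hd'
    all_goals simp only [hmem, Sym2.mem_iff, or_assoc]
    exacts [hw.1, hw.2, hz.1, hz.2]
  have t₁ (u v x y) := transfer u v x y (.inl 0) (.inr 0) (.inl 1) (.inr 1) (by decide) h₁
  have t₂ (u v x y) := transfer u v x y (.inl 0) (.inr 2) (.inl 2) (.inr 3) (by decide) h₂
  have pair (i j k l) (hik : i ≠ k) (hjl : j ≠ l) (h : D.Meet (p i) (q j) (p k) (q l)) :
      (i, j, k, l) = (0, 0, 1, 1) ∨ (i, j, k, l) = (1, 1, 0, 0) ∨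
        (i, j, k, l) = (0, 2, 2, 3) ∨ (i, j, k, l) = (2, 3, 0, 2) := by
    have h1 := t₁ (.inl i) (.inr j) (.inl k) (.inr l) (by simp [hik, hjl]) h
    have h2 := t₂ (.inl i) (.inr j) (.inl k) (.inr l) (by simp [hik, hjl]) h
    clear * - h1 h2 hik hjl
    revert i j k l
    decide
  have inner (s k : Fin 3) (l : Fin 4) (hs : s = 0 ∨ s = 1) (hl : l ≠ 3) (hl' : l ≠ s.castSucc)
      (hk : k ≠ s) (h : D.Meet (q 3) (q s.castSucc) (p k) (q l)) : False := by
    have h1 := t₁ (.inr 3) (.inr s.castSucc) (.inl k) (.inr l) (by simp [hl.symm, hl'.symm]) h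
    have h2 := t₂ (.inr 3) (.inr s.castSucc) (.inl k) (.inr l) (by simp [hl.symm, hl'.symm]) h
    clear * - h1 h2 hs hl hl' hk
    revert s k l
    decide
  have main (σ : Fin 3 → Fin 3) (hσ : Function.Injective σ) (h0 : σ 0 = 0 ∨ σ 0 = 1)
      (h : G.Adj (q (σ 0).castSucc) (q 3)) : False := by
    have hτ : Function.Injective fun j => (σ j).castSucc :=
      (Fin.castSucc_injective 3).comp hσ
    have hτ3 (j : Fin 3) : (σ j).castSucc ≠ 3 := (Fin.castSucc_lt_last _).ne
    rcases D.exists_meet_K33_subdivided (a := p ∘ σ) (b := fun j => q (σ j).castSucc) (w := q 3)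
      (fun i j _ => hadj _ _) (hadj _ _) h.symm with
      ⟨i, j, k, l, hik, hjl, hij, hkl, hm⟩ | ⟨k, l, hk, hl, hm | hm⟩
    · have hij' : (σ i, (σ j).castSucc) ≠ (σ 0, (σ 0).castSucc) := by
        simpa [hσ.eq_iff] using hij
      have hkl' : (σ k, (σ l).castSucc) ≠ (σ 0, (σ 0).castSucc) := by
        simpa [hσ.eq_iff] using hkl
      have h1 := pair _ _ _ _ (hσ.ne hik) (hτ.ne hjl) hm
      simp only [Prod.mk.injEq] at h1
      rcases h1 with ⟨e1, e2, e3, e4⟩ | ⟨e1, e2, e3, e4⟩ | ⟨e1, e2, e3, e4⟩ | ⟨e1, e2, e3, e4⟩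
      · rcases h0 with h0 | h0
        · exact hij' (by rw [e1, e2, h0]; rfl)
        · exact hkl' (by rw [e3, e4, h0]; rfl)
      · rcases h0 with h0 | h0
        · exact hkl' (by rw [e3, e4, h0]; rfl)
        · exact hij' (by rw [e1, e2, h0]; rfl)
      · exact hτ3 l e4
      · exact hτ3 j e2
    · have h1 := pair _ _ _ _ (hσ.ne hk.symm) (hτ3 l).symm hm
      simp only [Prod.mk.injEq] at h1
      rcases h1 with ⟨-, e2, -⟩ | ⟨-, e2, -⟩ | ⟨-, e2, -⟩ | ⟨e1, -⟩
      · exact absurd e2 (by decide)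
      · exact absurd e2 (by decide)
      · exact absurd e2 (by decide)
      · rw [e1] at h0
        exact absurd h0 (by decide)
    · exact inner _ _ _ h0 (hτ3 l) (hτ.ne hl) (hσ.ne hk) hm
  rcases hq' with h | h
  · exact main id Function.injective_id (.inl rfl) h
  · exact main ![1, 0, 2] (by decide) (.inr rfl) h

/-- A graph containing a complete bipartite graph `K_{3,4}` in whose side `q` of size four every
vertex has at most one non-neighbour, such as `K_{3,2,2}`, is not NIC-planar. -/
theorem not_nicPlanar_of_K34 {q : Fin 4 → V} (hp : Function.Injective p)
    (hq : Function.Injective q) (hadj : ∀ i j, G.Adj (p i) (q j))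
    (hq' : ∀ i j k, i ≠ j → i ≠ k → j ≠ k → G.Adj (q i) (q k) ∨ G.Adj (q j) (q k)) :
    ¬ G.NICPlanar := by
  rintro ⟨D, hD⟩
  obtain ⟨i, j, k, l, hik, hjl, h⟩ := D.exists_meet_K33 (b := q ∘ Fin.castSucc) fun i j => hadj i _
  replace hjl := (Fin.castSucc_injective 3).ne hjl
  simp only [Function.comp_apply] at h
  generalize j.castSucc = j at h hjl
  generalize l.castSucc = l at h hjl
  obtain ⟨i', j', k', l', hik', hjl', h'⟩ :=
    D.exists_meet_K33 (b := q ∘ j.succAbove) fun i j => hadj i _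
  replace hjl' := (Fin.succAbove_right_injective (p := j)).ne hjl'
  have hj := (Fin.succAbove_ne j j').symm
  have hj' := (Fin.succAbove_ne j l').symm
  simp only [Function.comp_apply] at h'
  generalize j.succAbove j' = j' at *
  generalize j.succAbove l' = l' at *
  obtain ⟨hl, hl', hne, hne'⟩ := trace_of_meet D hD hp hq hadj hik hjl hik' hjl' h h' hj hj'
  have main (i k k' : Fin 3) (j l j' l' : Fin 4) (hi : i ≠ k ∧ i ≠ k' ∧ k ≠ k')
      (hj : j ≠ l ∧ j ≠ j' ∧ j ≠ l' ∧ l ≠ j' ∧ l ≠ l' ∧ j' ≠ l')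
      (h₁ : D.Meet (p i) (q j) (p k) (q l)) (h₂ : D.Meet (p i) (q j') (p k') (q l')) : False := by
    refine not_meet_and_meet (p := p ∘ ![i, k, k']) (q := q ∘ ![j, l, j', l']) D hD
      (hp.comp ?_) (hq.comp ?_) (fun _ _ => hadj _ _) (hq' j l l' hj.1 hj.2.2.1 hj.2.2.2.2.1) h₁ h₂
    · clear * - hi
      revert i k k'
      decide
    · intro x y
      fin_cases x <;> fin_cases y <;> simp_all [Ne.symm]
  have common : i = i' ∧ k ≠ k' ∨ i = k' ∧ k ≠ i' ∨ k = i' ∧ i ≠ k' ∨ k = k' ∧ i ≠ i' := by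
    clear * - hik hik' hne hne'
    revert i k i' k'
    decide
  rcases common with ⟨rfl, hc⟩ | ⟨rfl, hc⟩ | ⟨rfl, hc⟩ | ⟨rfl, hc⟩
  · exact main i k k' j l j' l' ⟨hik, hik', hc⟩ ⟨hjl, hj, hj', hl, hl', hjl'⟩ h h'
  · exact main i k i' j l l' j' ⟨hik, hik'.symm, hc⟩ ⟨hjl, hj', hj, hl', hl, hjl'.symm⟩ h h'.symm
  · exact main k i k' l j j' l' ⟨hik.symm, hik', hc⟩ ⟨hjl.symm, hl, hl', hj, hj', hjl'⟩ h.symm h'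
  · exact main k i i' l j l' j' ⟨hik.symm, hik'.symm, hc⟩
      ⟨hjl.symm, hl', hl, hj', hj, hjl'.symm⟩ h.symm h'.symm

end Bipartite

section StraightLine

/-- Twice the signed area of the triangle `abc`. -/
def orient {R : Type*} [CommRing R] (a b c : R × R) : R :=
  (b.1 - a.1) * (c.2 - a.2) - (b.2 - a.2) * (c.1 - a.1)

/-- The segments `ab` and `cd` cross at an interior point of both, none of the four points being on
the line through the two points of the other segment. -/
def StrictlyCross {R : Type*} [CommRing R] [LT R] (a b c d : R × R) : Prop :=
  orient a b c * orient a b d < 0 ∧ orient c d a * orient c d b < 0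

instance (a b c d : ℤ × ℤ) : Decidable (StrictlyCross a b c d) :=
  inferInstanceAs (Decidable (_ ∧ _))

theorem mem_segment_iff_exists_add_smul {a b p : ℝ × ℝ} :
    p ∈ segment ℝ a b ↔ ∃ t ∈ Icc (0 : ℝ) 1, p = a + t • (b - a) := by
  rw [segment_eq_image']
  simp only [Set.mem_image, eq_comm]

theorem orient_eq_zero_of_mem_segment {a b p : ℝ × ℝ} (h : p ∈ segment ℝ a b) :
    orient a b p = 0 := by
  obtain ⟨t, -, rfl⟩ := mem_segment_iff_exists_add_smul.1 h
  simp only [orient, Prod.fst_add, Prod.smul_fst, Prod.fst_sub, Prod.snd_add, Prod.smul_snd,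
    Prod.snd_sub, smul_eq_mul]
  ring

theorem segment_inter_segment_subset {a b c : ℝ × ℝ} (h : orient a b c ≠ 0) :
    segment ℝ a b ∩ segment ℝ a c ⊆ {a} := by
  rintro p ⟨hb, hc⟩
  obtain ⟨t, -, rfl⟩ := mem_segment_iff_exists_add_smul.1 hc
  have h0 : t * orient a b c = 0 := by
    rw [← orient_eq_zero_of_mem_segment hb]
    simp only [orient, Prod.fst_add, Prod.smul_fst, Prod.fst_sub, Prod.snd_add, Prod.smul_snd,
      Prod.snd_sub, smul_eq_mul]
    ring
  simp [(mul_eq_zero.1 h0).resolve_right h]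

theorem mul_neg_of_mem_segment {a b c d p : ℝ × ℝ} (hp : p ∈ segment ℝ a b)
    (hp' : p ∈ segment ℝ c d) (hc : orient a b c ≠ 0) (hd : orient a b d ≠ 0) :
    orient a b c * orient a b d < 0 ∧ ∃ t ∈ Ioo (0 : ℝ) 1, p = c + t • (d - c) := by
  obtain ⟨t, ⟨ht0, ht1⟩, rfl⟩ := mem_segment_iff_exists_add_smul.1 hp'
  have h0 : (1 - t) * orient a b c + t * orient a b d = 0 := by
    rw [← orient_eq_zero_of_mem_segment hp]
    simp only [orient, Prod.fst_add, Prod.smul_fst, Prod.fst_sub, Prod.snd_add, Prod.smul_snd,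
      Prod.snd_sub, smul_eq_mul]
    ring
  have ht0' : t ≠ 0 := by
    rintro rfl
    simp [hc] at h0
  have ht1' : t ≠ 1 := by
    rintro rfl
    simp [hd] at h0
  have ht0 := ht0.lt_of_ne' ht0'
  refine ⟨?_, t, ⟨ht0, ht1.lt_of_ne ht1'⟩, rfl⟩
  have hsq : 0 < (1 - t) * orient a b c ^ 2 :=
    mul_pos (sub_pos.2 (ht1.lt_of_ne ht1')) (by positivity)
  have : t * (orient a b c * orient a b d) = - ((1 - t) * orient a b c ^ 2) := by
    linear_combination orient a b c * h0
  by_contra! hneg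
  nlinarith [mul_nonneg ht0.le hneg]

theorem det_ne_zero_of_strictlyCross {a b c d : ℝ × ℝ} (h : StrictlyCross a b c d) :
    (b - a).1 * (d - c).2 - (b - a).2 * (d - c).1 ≠ 0 := by
  intro h0
  have : orient a b c = orient a b d := by
    simp only [orient, Prod.fst_sub, Prod.snd_sub] at h0 ⊢
    linear_combination -h0
  have h1 := h.1
  rw [this] at h1
  exact absurd h1 (mul_self_nonneg _).not_gt

theorem segment_inter_segment_subsingleton {a b c d : ℝ × ℝ} (h : StrictlyCross a b c d) :
    (segment ℝ a b ∩ segment ℝ c d).Subsingleton := by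
  rintro p ⟨hp, hp'⟩ q ⟨hq, hq'⟩
  have key {p : ℝ × ℝ} (hp : p ∈ segment ℝ a b) (hp' : p ∈ segment ℝ c d) :
      ∃ t, p = c + t • (d - c) ∧ orient a b c + t * (orient a b d - orient a b c) = 0 := by
    obtain ⟨t, -, rfl⟩ := mem_segment_iff_exists_add_smul.1 hp'
    refine ⟨t, rfl, ?_⟩
    rw [← orient_eq_zero_of_mem_segment hp]
    simp only [orient, Prod.fst_add, Prod.smul_fst, Prod.fst_sub, Prod.snd_add, Prod.smul_snd,
      Prod.snd_sub, smul_eq_mul]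
    ring
  obtain ⟨s, rfl, hs⟩ := key hp hp'
  obtain ⟨t, rfl, ht⟩ := key hq hq'
  have hne : orient a b d - orient a b c ≠ 0 := by
    intro h0
    have h1 := h.1
    rw [sub_eq_zero.1 h0] at h1
    exact absurd h1 (mul_self_nonneg _).not_gt
  rw [mul_right_cancel₀ hne (show s * _ = t * _ by linear_combination hs - ht)]

theorem affine_mem_segment_iff {a d₁ d₂ : ℝ × ℝ} (hδ : d₁.1 * d₂.2 - d₁.2 * d₂.1 ≠ 0) {s ε : ℝ}
    (hε : 0 < ε) (hs : ε ≤ s) (hs' : ε ≤ 1 - s) {x y : ℝ} (hx : |x| < 1) :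
    a + s • d₁ + ((ε * x) • d₁ + (ε * y) • d₂) ∈ segment ℝ a (a + d₁) ↔ y = 0 := by
  rw [mem_segment_iff_exists_add_smul]
  constructor
  · rintro ⟨t, -, ht⟩
    have h1 := congrArg Prod.fst ht
    have h2 := congrArg Prod.snd ht
    simp only [Prod.fst_add, Prod.smul_fst, Prod.snd_add, Prod.smul_snd, smul_eq_mul,
      add_sub_cancel_left] at h1 h2
    have : (ε * y) * (d₁.1 * d₂.2 - d₁.2 * d₂.1) = 0 := by
      linear_combination d₁.1 * h2 - d₁.2 * h1
    simpa [hε.ne', hδ] using this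
  · rintro rfl
    rw [abs_lt] at hx
    exact ⟨s + ε * x, ⟨by nlinarith, by nlinarith⟩, by simp [add_smul, add_assoc]⟩

/-- The affine coordinates in the plane with origin `p` and basis `d₁`, `d₂`. -/
noncomputable def planeAffineHomeomorph (p d₁ d₂ : ℝ × ℝ) (hδ : d₁.1 * d₂.2 - d₁.2 * d₂.1 ≠ 0) :
    (ℝ × ℝ) ≃ₜ (ℝ × ℝ) where
  toFun w := p + (w.1 • d₁ + w.2 • d₂)
  invFun q := (((q - p).1 * d₂.2 - (q - p).2 * d₂.1) / (d₁.1 * d₂.2 - d₁.2 * d₂.1),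
    (d₁.1 * (q - p).2 - d₁.2 * (q - p).1) / (d₁.1 * d₂.2 - d₁.2 * d₂.1))
  left_inv w := by
    ext
    · simp only [add_sub_cancel_left, Prod.fst_add, Prod.smul_fst, Prod.snd_add, Prod.smul_snd,
        smul_eq_mul]
      rw [div_eq_iff hδ]
      ring
    · simp only [add_sub_cancel_left, Prod.fst_add, Prod.smul_fst, Prod.snd_add, Prod.smul_snd,
        smul_eq_mul]
      rw [div_eq_iff hδ]
      ring
  right_inv q := by
    obtain ⟨δ, h⟩ : ∃ δ, d₁.1 * d₂.2 - d₁.2 * d₂.1 = δ := ⟨_, rfl⟩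
    rw [h] at hδ
    ext
    · simp only [Prod.fst_sub, Prod.snd_sub, Prod.fst_add, Prod.smul_fst, smul_eq_mul, h]
      field_simp
      linear_combination (q.1 - p.1) * h
    · simp only [Prod.fst_sub, Prod.snd_sub, Prod.snd_add, Prod.smul_snd, smul_eq_mul, h]
      field_simp
      linear_combination (q.2 - p.2) * h
  continuous_toFun := by fun_prop
  continuous_invFun := by fun_prop

theorem properCross_segment {a d₁ c d₂ p : ℝ × ℝ} (hδ : d₁.1 * d₂.2 - d₁.2 * d₂.1 ≠ 0) {s t : ℝ}
    (hs : s ∈ Ioo (0 : ℝ) 1) (ht : t ∈ Ioo (0 : ℝ) 1) (hp : p = a + s • d₁)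
    (hp' : p = c + t • d₂) :
    ProperCross (segment ℝ a (a + d₁)) (segment ℝ c (c + d₂)) p := by
  obtain ⟨ε, hε, hεs, hεs', hεt, hεt'⟩ :
      ∃ ε : ℝ, 0 < ε ∧ ε ≤ s ∧ ε ≤ 1 - s ∧ ε ≤ t ∧ ε ≤ 1 - t := by
    refine ⟨min (min s (1 - s)) (min t (1 - t)), ?_, ?_⟩
    · simp [hs.1, hs.2, ht.1, ht.2]
    · simp
  have hδε : (ε • d₁).1 * (ε • d₂).2 - (ε • d₁).2 * (ε • d₂).1 ≠ 0 := by
    have : ε ^ 2 * (d₁.1 * d₂.2 - d₁.2 * d₂.1) ≠ 0 := mul_ne_zero (by positivity) hδ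
    convert this using 1
    simp only [Prod.smul_fst, Prod.smul_snd, smul_eq_mul]
    ring
  set A := planeAffineHomeomorph p (ε • d₁) (ε • d₂) hδε
  have hA (w : ℝ × ℝ) : A w = p + ((ε * w.1) • d₁ + (ε * w.2) • d₂) := by
    simp [A, planeAffineHomeomorph, smul_smul, mul_comm]
  set ψ : A '' Metric.ball 0 1 ≃ₜ ℝ × ℝ :=
    (A.image (Metric.ball 0 1)).symm.trans Homeomorph.unitBall.symm
  have hψ (w : ℝ × ℝ) : ∃ r : ℝ, 0 < r ∧ r • w ∈ Metric.ball 0 1 ∧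
      ((ψ.symm w : A '' Metric.ball 0 1) : ℝ × ℝ) = A (r • w) := by
    refine ⟨(√(1 + ‖w‖ ^ 2))⁻¹, by positivity, ?_, rfl⟩
    exact (Homeomorph.unitBall w).2
  have himage (S : Set (ℝ × ℝ)) : (fun x => ψ x) '' {x | (x : ℝ × ℝ) ∈ S} =
      {w | ((ψ.symm w : A '' Metric.ball 0 1) : ℝ × ℝ) ∈ S} :=
    ψ.toEquiv.image_eq_preimage_symm _
  have hball {w : ℝ × ℝ} (hw : w ∈ Metric.ball 0 1) : |w.1| < 1 ∧ |w.2| < 1 := by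
    rw [mem_ball_zero_iff, Prod.norm_def, max_lt_iff] at hw
    exact hw
  have hA0 : A 0 = p := by simp [hA]
  have hpU : p ∈ A '' Metric.ball 0 1 := ⟨0, by simp, hA0⟩
  refine ⟨A '' Metric.ball 0 1, A.isOpenMap _ Metric.isOpen_ball, hpU, ψ, ?_, ?_, ?_⟩
  · rw [← Homeomorph.eq_symm_apply]
    ext1
    obtain ⟨r, -, -, hr⟩ := hψ 0
    rw [Prod.mk_zero_zero, hr, smul_zero, hA0]
  · rw [himage]
    ext w
    obtain ⟨r, hr0, hr1, hr⟩ := hψ w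
    rw [mem_ofPred, mem_ofPred, hr, hA, hp,
      affine_mem_segment_iff hδ hε hεs hεs' (hball hr1).1]
    simp [hr0.ne']
  · rw [himage]
    ext w
    obtain ⟨r, hr0, hr1, hr⟩ := hψ w
    rw [mem_ofPred, mem_ofPred, hr, hA, hp', add_comm ((ε * (r • w).1) • d₁),
      affine_mem_segment_iff (fun h => hδ (by linear_combination -h)) hε hεt hεt' (hball hr1).2]
    simp [hr0.ne']

end StraightLine

namespace SimpleGraph

variable {V : Type*} [Finite V] {G : SimpleGraph V}

/-- A straight-line drawing in general position is NIC-planar as soon as two crossings that share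
two vertices are the same. -/
theorem nicPlanar_of_straightLine (pos : V → ℝ × ℝ) (hinj : Function.Injective pos)
    (hgen : ∀ u v w, u ≠ v → u ≠ w → v ≠ w → orient (pos u) (pos v) (pos w) ≠ 0)
    (hX : ∀ u v x y u' v' x' y', G.Adj u v → G.Adj x y → G.Adj u' v' → G.Adj x' y' →
      StrictlyCross (pos u) (pos v) (pos x) (pos y) →
      StrictlyCross (pos u') (pos v') (pos x') (pos y') → ∀ w z, w ≠ z →
      (w ∈ s(u, v) ∨ w ∈ s(x, y)) → (w ∈ s(u', v') ∨ w ∈ s(x', y')) →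
      (z ∈ s(u, v) ∨ z ∈ s(x, y)) → (z ∈ s(u', v') ∨ z ∈ s(x', y')) →
      s(s(u, v), s(x, y)) = s(s(u', v'), s(x', y'))) : G.NICPlanar := by
  set arc : G.edgeSet → ℝ → ℝ × ℝ := fun e =>
    AffineMap.lineMap (pos (e : Sym2 V).out.1) (pos (e : Sym2 V).out.2) with harc
  have hout (e : Sym2 V) : s(e.out.1, e.out.2) = e := Quot.out_eq e
  have him (e : G.edgeSet) {u v : V} (h : (e : Sym2 V) = s(u, v)) :
      arc e '' Icc 0 1 = segment ℝ (pos u) (pos v) := by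
    rw [harc, ← segment_eq_image_lineMap]
    rw [← hout e, Sym2.eq_iff] at h
    rcases h with ⟨h1, h2⟩ | ⟨h1, h2⟩
    · rw [h1, h2]
    · rw [h1, h2, segment_symm]
  have hends (e : G.edgeSet) {v : V} (hv : v ∈ (e : Sym2 V)) :
      ∃ u, (e : Sym2 V) = s(v, u) ∧ G.Adj v u := by
    obtain ⟨u, hu⟩ := hv
    exact ⟨u, hu, by simpa [hu] using e.2⟩
  have shared (e₁ e₂ : G.edgeSet) (hne : e₁ ≠ e₂) (v : V) (h₁ : v ∈ (e₁ : Sym2 V))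
      (h₂ : v ∈ (e₂ : Sym2 V)) : arc e₁ '' Icc 0 1 ∩ arc e₂ '' Icc 0 1 ⊆ {pos v} := by
    obtain ⟨u, hu, huv⟩ := hends e₁ h₁
    obtain ⟨w, hw, hwv⟩ := hends e₂ h₂
    rw [him e₁ hu, him e₂ hw]
    refine segment_inter_segment_subset (hgen _ _ _ huv.ne hwv.ne ?_)
    rintro rfl
    exact hne (Subtype.ext (hu.trans hw.symm))
  have cross (e₁ e₂ : G.edgeSet) (hd : ∀ v ∈ (e₁ : Sym2 V), v ∉ (e₂ : Sym2 V)) (p : ℝ × ℝ)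
      (h₁ : p ∈ arc e₁ '' Icc 0 1) (h₂ : p ∈ arc e₂ '' Icc 0 1) :
      ∃ u v x y, (e₁ : Sym2 V) = s(u, v) ∧ (e₂ : Sym2 V) = s(x, y) ∧ G.Adj u v ∧ G.Adj x y ∧
        StrictlyCross (pos u) (pos v) (pos x) (pos y) ∧
        ProperCross (arc e₁ '' Icc 0 1) (arc e₂ '' Icc 0 1) p := by
    obtain ⟨⟨u, v⟩, huv⟩ := e₁
    obtain ⟨⟨x, y⟩, hxy⟩ := e₂
    change G.Adj u v at huv
    change G.Adj x y at hxy
    change ∀ w ∈ s(u, v), w ∉ s(x, y) at hd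
    simp only [Sym2.mem_iff, forall_eq_or_imp, forall_eq, not_or] at hd
    obtain ⟨⟨hux, huy⟩, hvx, hvy⟩ := hd
    rw [him _ rfl] at h₁ h₂ ⊢
    rw [him _ rfl]
    obtain ⟨hc, t, ht, hpt⟩ := mul_neg_of_mem_segment h₁ h₂ (hgen _ _ _ huv.ne hux hvx)
      (hgen _ _ _ huv.ne huy hvy)
    obtain ⟨hc', s, hs, hps⟩ := mul_neg_of_mem_segment h₂ h₁
      (hgen _ _ _ hxy.ne (Ne.symm hux) (Ne.symm huy))
      (hgen _ _ _ hxy.ne (Ne.symm hvx) (Ne.symm hvy))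
    refine ⟨u, v, x, y, rfl, rfl, huv, hxy, ⟨hc, hc'⟩, ?_⟩
    simpa using properCross_segment (det_ne_zero_of_strictlyCross ⟨hc, hc'⟩) hs ht hps hpt
  have disj {e₁ e₂ : G.edgeSet} (hne : e₁ ≠ e₂) {p : ℝ × ℝ} (hp : p ∉ Set.range pos)
      (h₁ : p ∈ arc e₁ '' Icc 0 1) (h₂ : p ∈ arc e₂ '' Icc 0 1) :
      ∀ v ∈ (e₁ : Sym2 V), v ∉ (e₂ : Sym2 V) := fun v hv hv' =>
    hp ⟨v, (shared e₁ e₂ hne v hv hv' ⟨h₁, h₂⟩).symm⟩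
  have same {e₁ e₂ e₁' e₂' : G.edgeSet} (hne : e₁ ≠ e₂) (hne' : e₁' ≠ e₂') {p p' : ℝ × ℝ}
      (hp : p ∉ Set.range pos) (hp' : p' ∉ Set.range pos) (h₁ : p ∈ arc e₁ '' Icc 0 1)
      (h₂ : p ∈ arc e₂ '' Icc 0 1) (h₁' : p' ∈ arc e₁' '' Icc 0 1)
      (h₂' : p' ∈ arc e₂' '' Icc 0 1) {w z : V} (hwz : w ≠ z)
      (hw : w ∈ (e₁ : Sym2 V) ∨ w ∈ (e₂ : Sym2 V)) (hw' : w ∈ (e₁' : Sym2 V) ∨ w ∈ (e₂' : Sym2 V))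
      (hz : z ∈ (e₁ : Sym2 V) ∨ z ∈ (e₂ : Sym2 V))
      (hz' : z ∈ (e₁' : Sym2 V) ∨ z ∈ (e₂' : Sym2 V)) :
      p = p' ∧ (e₁ = e₁' ∧ e₂ = e₂' ∨ e₁ = e₂' ∧ e₂ = e₁') := by
    obtain ⟨u, v, x, y, h1, h2, huv, hxy, hc, -⟩ := cross e₁ e₂ (disj hne hp h₁ h₂) p h₁ h₂
    obtain ⟨u', v', x', y', h1', h2', huv', hxy', hc', -⟩ :=
      cross e₁' e₂' (disj hne' hp' h₁' h₂') p' h₁' h₂'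
    have key := hX u v x y u' v' x' y' huv hxy huv' hxy' hc hc' w z hwz
    rw [← h1, ← h2, ← h1', ← h2'] at key
    replace key := key hw hw' hz hz'
    simp only [Sym2.eq_iff, ← Subtype.ext_iff] at key
    refine ⟨?_, key⟩
    rw [him e₁ h1] at h₁
    rw [him e₂ h2] at h₂
    refine segment_inter_segment_subsingleton hc ⟨h₁, h₂⟩ ?_
    rw [← him e₁ h1, ← him e₂ h2]
    rcases key with ⟨rfl, rfl⟩ | ⟨rfl, rfl⟩
    exacts [⟨h₁', h₂'⟩, ⟨h₂', h₁'⟩]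
  have unique {e e₁ e₂ : G.edgeSet} (hne₁ : e ≠ e₁) (hne₂ : e ≠ e₂) {p p' : ℝ × ℝ}
      (hp : p ∉ Set.range pos) (hp' : p' ∉ Set.range pos) (h : p ∈ arc e '' Icc 0 1)
      (h' : p' ∈ arc e '' Icc 0 1) (h₁ : p ∈ arc e₁ '' Icc 0 1) (h₂ : p' ∈ arc e₂ '' Icc 0 1) :
      p = p' ∧ e₁ = e₂ := by
    obtain ⟨u, hu, huv⟩ := hends e (Sym2.out_fst_mem _)
    have h_fst := Sym2.out_fst_mem (e : Sym2 V)
    have h_snd : u ∈ (e : Sym2 V) := by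
      rw [hu]
      exact Sym2.mem_mk_right _ _
    obtain ⟨h1, h2⟩ := same hne₁ hne₂ hp hp' h h₁ h' h₂ huv.ne (.inl h_fst) (.inl h_fst)
      (.inl h_snd) (.inl h_snd)
    exact ⟨h1, h2.elim And.right fun h3 => (hne₂ h3.1).elim⟩
  let D : Drawing G :=
    { pos := pos
      pos_inj := hinj
      arc := arc
      arc_cont := fun e => AffineMap.lineMap_continuous.continuousOn
      arc_inj := fun e => by
        obtain ⟨u, hu, huv⟩ := hends e (Sym2.out_fst_mem _)
        refine (AffineMap.lineMap_injective ℝ (hinj.ne ?_)).injOn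
        have := e.2
        rw [← hout e] at this
        exact this.ne
      arc_ends := fun e => ⟨_, _, (hout e).symm, by simp [harc], by simp [harc]⟩
      no_vertex_interior := fun e w hw hmem => by
        obtain ⟨u, hu, huv⟩ := hends e (Sym2.out_fst_mem _)
        rw [him e hu] at hmem
        rw [hu, Sym2.mem_iff, not_or] at hw
        exact hgen _ _ _ huv.ne (Ne.symm hw.1) (Ne.symm hw.2) (orient_eq_zero_of_mem_segment hmem)
      shared_endpoint := shared
      finite_meet := fun e₁ e₂ hne => by
        by_cases hd : ∀ v ∈ (e₁ : Sym2 V), v ∉ (e₂ : Sym2 V)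
        · refine Set.Subsingleton.finite fun p hp q hq => ?_
          obtain ⟨u, v, x, y, h1, h2, -, -, hc, -⟩ := cross e₁ e₂ hd p hp.1 hp.2
          rw [him e₁ h1, him e₂ h2] at hp hq
          exact segment_inter_segment_subsingleton hc hp hq
        · push Not at hd
          obtain ⟨v, hv, hv'⟩ := hd
          exact (Set.finite_singleton _).subset (shared e₁ e₂ hne v hv hv')
      proper := fun e₁ e₂ hne p hp hpos => by
        obtain ⟨-, -, -, -, -, -, -, -, -, h⟩ :=
          cross e₁ e₂ (disj hne hpos hp.1 hp.2) p hp.1 hp.2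
        exact h
      at_most_two := fun p hp e₁ e₂ e₃ h₁ h₂ h₃ => by
        by_cases h12 : e₁ = e₂
        · exact .inl h12
        by_cases h13 : e₁ = e₃
        · exact .inr (.inl h13)
        exact .inr (.inr (unique h12 h13 hp hp h₁ h₁ h₂ h₃).2) }
  refine ⟨D, fun e p hp p' hp' => ?_, fun p hp p' hp' hne => ?_⟩
  · have other {p : ℝ × ℝ} (hp : p ∈ D.crossings) : ∃ e', e ≠ e' ∧ p ∈ arc e' '' Icc 0 1 := by
      obtain ⟨-, e₁, e₂, hne, h1, h2⟩ := hp
      by_cases he : e = e₁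
      · exact ⟨e₂, he ▸ hne, h2⟩
      · exact ⟨e₁, he, h1⟩
    obtain ⟨e₁, he₁, h₁⟩ := other hp.1
    obtain ⟨e₂, he₂, h₂⟩ := other hp'.1
    exact (unique he₁ he₂ hp.1.1 hp'.1.1 hp.2 hp'.2 h₁ h₂).1
  · obtain ⟨hpos, e₁, e₂, hne₁, h1, h2⟩ := hp
    obtain ⟨hpos', e₁', e₂', hne₂, h1', h2'⟩ := hp'
    have mem_of_mem_cluster {p : ℝ × ℝ} {e₁ e₂ : G.edgeSet} (hpos : p ∉ Set.range pos)
        (hne : e₁ ≠ e₂) (h1 : p ∈ arc e₁ '' Icc 0 1) (h2 : p ∈ arc e₂ '' Icc 0 1) {v : V}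
        (hv : v ∈ D.cluster p) : v ∈ (e₁ : Sym2 V) ∨ v ∈ (e₂ : Sym2 V) := by
      obtain ⟨e, he, hv⟩ := hv
      rcases D.at_most_two p hpos e₁ e₂ e h1 h2 he with h | h | h
      exacts [(hne h).elim, .inl (h ▸ hv), .inr (h ▸ hv)]
    rw [Set.ncard_le_one]
    rintro w ⟨hw, hw'⟩ z ⟨hz, hz'⟩
    by_contra hwz
    exact hne (same hne₁ hne₂ hpos hpos' h1 h2 h1' h2' hwz (mem_of_mem_cluster hpos hne₁ h1 h2 hw)
      (mem_of_mem_cluster hpos' hne₂ h1' h2' hw') (mem_of_mem_cluster hpos hne₁ h1 h2 hz)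
      (mem_of_mem_cluster hpos' hne₂ h1' h2' hz')).1

end SimpleGraph

section IntegerPoints

variable {V : Type*} {G : SimpleGraph V} {n : ℕ}

/-- The inclusion of the integer lattice into the plane. -/
def latticePoint (a : ℤ × ℤ) : ℝ × ℝ := (a.1, a.2)

theorem latticePoint_injective : Function.Injective latticePoint := fun a b h => by
  simpa [latticePoint, Prod.ext_iff] using h

theorem orient_latticePoint (a b c : ℤ × ℤ) :
    orient (latticePoint a) (latticePoint b) (latticePoint c) = (orient a b c : ℤ) := by
  simp [orient, latticePoint]

theorem strictlyCross_latticePoint (a b c d : ℤ × ℤ) :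
    StrictlyCross (latticePoint a) (latticePoint b) (latticePoint c) (latticePoint d) ↔
      StrictlyCross a b c d := by
  simp only [StrictlyCross, orient_latticePoint]
  norm_cast

/-- A straight-line drawing on lattice points in general position is NIC-planar if it has at most
two crossings, whose cluster sets share at most one vertex. -/
theorem nicPlanar_of_lattice {f : V → Fin n} (hf : Function.Injective f) {r : Fin n → Fin n → Prop}
    (hr : ∀ u v, G.Adj u v → r (f u) (f v)) (P : Fin n → ℤ × ℤ) (hP : Function.Injective P)
    (hgen : ∀ u v w, u ≠ v → u ≠ w → v ≠ w → orient (P u) (P v) (P w) ≠ 0)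
    (a b : Fin 4 → Fin n) (hab : ∀ i j k l, a i = b j → a k = b l → a i = a k)
    (hX : ∀ u v, r u v → ∀ x y, r x y → StrictlyCross (P u) (P v) (P x) (P y) →
      s(s(u, v), s(x, y)) = s(s(a 0, a 1), s(a 2, a 3)) ∨
      s(s(u, v), s(x, y)) = s(s(b 0, b 1), s(b 2, b 3))) : G.NICPlanar := by
  have : Finite V := Finite.of_injective f hf
  refine SimpleGraph.nicPlanar_of_straightLine (fun v => latticePoint (P (f v)))
    (latticePoint_injective.comp (hP.comp hf)) (fun u v w huv huw hvw => ?_) ?_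
  · rw [orient_latticePoint]
    exact_mod_cast hgen _ _ _ (hf.ne huv) (hf.ne huw) (hf.ne hvw)
  intro u v x y u' v' x' y' huv hxy huv' hxy' hc hc' w z hwz hw hw' hz hz'
  rw [strictlyCross_latticePoint] at hc hc'
  have h := hX _ _ (hr _ _ huv) _ _ (hr _ _ hxy) hc
  have h' := hX _ _ (hr _ _ huv') _ _ (hr _ _ hxy') hc'
  have hmem {u v x y w : V} {c : Fin 4 → Fin n}
      (h : s(s(f u, f v), s(f x, f y)) = s(s(c 0, c 1), s(c 2, c 3)))
      (hw : w ∈ s(u, v) ∨ w ∈ s(x, y)) : ∃ i, f w = c i := by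
    simp only [Sym2.eq_iff, Sym2.mem_iff] at h hw
    grind
  have hdiff {u v x y u' v' x' y' : V}
      (h : s(s(f u, f v), s(f x, f y)) = s(s(a 0, a 1), s(a 2, a 3)))
      (h' : s(s(f u', f v'), s(f x', f y')) = s(s(b 0, b 1), s(b 2, b 3)))
      (hw : w ∈ s(u, v) ∨ w ∈ s(x, y)) (hw' : w ∈ s(u', v') ∨ w ∈ s(x', y'))
      (hz : z ∈ s(u, v) ∨ z ∈ s(x, y)) (hz' : z ∈ s(u', v') ∨ z ∈ s(x', y')) : False := by
    obtain ⟨i, hi⟩ := hmem h hw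
    obtain ⟨j, hj⟩ := hmem h' hw'
    obtain ⟨k, hk⟩ := hmem h hz
    obtain ⟨l, hl⟩ := hmem h' hz'
    exact hwz (hf (hi.trans ((hab i j k l (hi.symm.trans hj) (hk.symm.trans hl)).trans hk.symm)))
  refine Sym2.map.injective (Sym2.map.injective hf) ?_
  simp only [Sym2.map_mk]
  rcases h with h | h <;> rcases h' with hs | hs
  · exact h.trans hs.symm
  · exact (hdiff h hs hw hw' hz hz').elim
  · exact (hdiff hs h hw' hw hz' hz).elim
  · exact h.trans hs.symm

/-- The complete four-partite graph `K_{4,1,1,1}`, drawn with two crossings. -/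
theorem nicPlanar_of_K4111 {f : V → Fin 7} (hf : Function.Injective f)
    (hr : ∀ u v, G.Adj u v → ¬ (f u < 4 ∧ f v < 4)) : G.NICPlanar := by
  refine nicPlanar_of_lattice hf (r := fun u v => ¬ (u < 4 ∧ v < 4)) hr
    ![(1, 9), (2, 1), (6, 2), (0, 10), (11, 2), (0, 0), (7, 4)] (by decide) (by decide)
    ![0, 4, 3, 6] ![1, 4, 2, 5] (by decide) (by decide)

/-- The complete four-partite graph `K_{2,2,1,1}`, drawn with one crossing. -/
theorem nicPlanar_of_K2211 {f : V → Fin 6} (hf : Function.Injective f)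
    (hr : ∀ u v, G.Adj u v → ¬ (f u < 2 ∧ f v < 2) ∧ s(f u, f v) ≠ s(2, 3)) : G.NICPlanar := by
  refine nicPlanar_of_lattice hf (r := fun u v => ¬ (u < 2 ∧ v < 2) ∧ s(u, v) ≠ s(2, 3)) hr
    ![(5, 4), (7, 0), (7, 5), (5, 1), (6, 4), (0, 2)] (by decide) (by decide)
    ![0, 3, 4, 5] ![0, 0, 0, 0] (by decide) (by decide)

end IntegerPoints

section FourPartite

theorem completeMultipartite_adj {k : ℕ} {a : Fin k → ℕ} {u v : Σ i : Fin k, Fin (a i)} :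
    (completeMultipartite a).Adj u v ↔ u.1 ≠ v.1 :=
  Iff.rfl

theorem nicPlanar_completeMultipartite_one {a : ℕ} (ha : a ≤ 4) :
    (completeMultipartite ![a, 1, 1, 1]).NICPlanar := by
  have bound (v : Σ i : Fin 4, Fin (![a, 1, 1, 1] i)) : ![0, 4, 5, 6] v.1 + (v.2 : ℕ) < 7 := by
    obtain ⟨i, j, hj⟩ := v
    fin_cases i <;> simp at hj ⊢ <;> omega
  refine nicPlanar_of_K4111 (f := fun v => ⟨_, bound v⟩) ?_ ?_
  · rintro ⟨i, j, hj⟩ ⟨k, l, hl⟩ h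
    obtain rfl : i = k := by
      fin_cases i <;> fin_cases k <;> simp at hj hl h ⊢ <;> omega
    obtain rfl : j = l := by simpa using h
    rfl
  · rintro ⟨i, j, hj⟩ ⟨k, l, hl⟩ h
    rw [completeMultipartite_adj] at h
    fin_cases i <;> fin_cases k <;> simp [Fin.lt_def] at hj hl h ⊢ <;> omega

theorem nicPlanar_completeMultipartite_two :
    (completeMultipartite ![2, 2, 1, 1]).NICPlanar := by
  have bound (v : Σ i : Fin 4, Fin (![2, 2, 1, 1] i)) : ![0, 2, 4, 5] v.1 + (v.2 : ℕ) < 6 := by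
    obtain ⟨i, j, hj⟩ := v
    fin_cases i <;> simp at hj ⊢ <;> omega
  refine nicPlanar_of_K2211 (f := fun v => ⟨_, bound v⟩) ?_ ?_
  · rintro ⟨i, j, hj⟩ ⟨k, l, hl⟩ h
    obtain rfl : i = k := by
      fin_cases i <;> fin_cases k <;> simp at hj hl h ⊢ <;> omega
    obtain rfl : j = l := by simpa using h
    rfl
  · rintro ⟨i, j, hj⟩ ⟨k, l, hl⟩ h
    rw [completeMultipartite_adj] at h
    fin_cases i <;> fin_cases k <;>
      simp [Fin.lt_def, Fin.ext_iff] at hj hl h ⊢ <;> omega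

theorem not_nicPlanar_completeMultipartite_of_five_le {a₁ a₂ a₃ a₄ : ℕ} (h₁ : 5 ≤ a₁)
    (h₂ : 0 < a₂) (h₃ : 0 < a₃) (h₄ : 0 < a₄) :
    ¬ (completeMultipartite ![a₁, a₂, a₃, a₄]).NICPlanar := by
  refine not_nicPlanar_of_K35 (p := ![⟨1, 0, h₂⟩, ⟨2, 0, h₃⟩, ⟨3, 0, h₄⟩])
    (q := fun j => ⟨0, Fin.castLE h₁ j⟩) ?_ ?_ ?_
  · intro i j h
    replace h := congrArg (fun v => (v.1, (v.2 : ℕ))) h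
    fin_cases i <;> fin_cases j <;> simp at h ⊢
  · exact sigma_mk_injective.comp (Fin.castLE_injective h₁)
  · intro i j
    rw [completeMultipartite_adj]
    fin_cases i <;> simp

theorem not_nicPlanar_completeMultipartite_of_three_le {a₁ a₂ a₃ a₄ : ℕ} (h₁ : 3 ≤ a₁)
    (h₂ : 2 ≤ a₂) (h₃ : 0 < a₃) (h₄ : 0 < a₄) :
    ¬ (completeMultipartite ![a₁, a₂, a₃, a₄]).NICPlanar := by
  refine not_nicPlanar_of_K34 (p := fun j => ⟨0, Fin.castLE h₁ j⟩)
    (q := ![⟨1, 0, by simp; omega⟩, ⟨1, 1, h₂⟩, ⟨2, 0, h₃⟩, ⟨3, 0, h₄⟩]) ?_ ?_ ?_ ?_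
  · exact sigma_mk_injective.comp (Fin.castLE_injective h₁)
  · intro i j h
    replace h := congrArg (fun v => (v.1, (v.2 : ℕ))) h
    fin_cases i <;> fin_cases j <;> simp at h ⊢
  · intro i j
    rw [completeMultipartite_adj]
    fin_cases j <;> simp
  · intro i j k hij hik hjk
    simp only [completeMultipartite_adj]
    fin_cases i <;> fin_cases j <;> fin_cases k <;> simp at hij hik hjk ⊢

theorem not_nicPlanar_completeMultipartite_of_two_le {a₁ a₂ a₃ a₄ : ℕ} (h₁ : 2 ≤ a₁)
    (h₂ : 2 ≤ a₂) (h₃ : 2 ≤ a₃) (h₄ : 0 < a₄) :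
    ¬ (completeMultipartite ![a₁, a₂, a₃, a₄]).NICPlanar := by
  refine not_nicPlanar_of_K34
    (p := ![⟨0, 0, by simp; omega⟩, ⟨0, 1, h₁⟩, ⟨3, 0, h₄⟩])
    (q := ![⟨1, 0, by simp; omega⟩, ⟨1, 1, h₂⟩, ⟨2, 0, by simp; omega⟩, ⟨2, 1, h₃⟩]) ?_ ?_ ?_ ?_
  · intro i j h
    replace h := congrArg (fun v => (v.1, (v.2 : ℕ))) h
    fin_cases i <;> fin_cases j <;> simp at h ⊢
  · intro i j h
    replace h := congrArg (fun v => (v.1, (v.2 : ℕ))) h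
    fin_cases i <;> fin_cases j <;> simp at h ⊢
  · intro i j
    rw [completeMultipartite_adj]
    fin_cases i <;> fin_cases j <;> simp
  · intro i j k hij hik hjk
    simp only [completeMultipartite_adj]
    fin_cases i <;> fin_cases j <;> fin_cases k <;> simp at hij hik hjk ⊢

end FourPartite

/-- for positive integers `a₁ ≥ a₂ ≥ a₃ ≥ a₄`, the complete
4-partite graph `K_{a₁,a₂,a₃,a₄}` is NIC-planar iff `a₁ ≤ 4` and `a₂ = 1`, or
`a₁ = a₂ = 2` and `a₃ = 1`. -/
theorem stmt7 (a₁ a₂ a₃ a₄ : ℕ) (h₄ : 0 < a₄) (h₄₃ : a₄ ≤ a₃) (h₃₂ : a₃ ≤ a₂)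
    (h₂₁ : a₂ ≤ a₁) :
    (completeMultipartite ![a₁, a₂, a₃, a₄]).NICPlanar ↔
      (a₁ ≤ 4 ∧ a₂ = 1) ∨ (a₁ = 2 ∧ a₂ = 2 ∧ a₃ = 1) := by
  refine ⟨fun h => ?_, ?_⟩
  · by_contra! hneg
    rcases le_or_gt 5 a₁ with h5 | h5
    · exact not_nicPlanar_completeMultipartite_of_five_le h5 (by omega) (by omega) h₄ h
    rcases le_or_gt 3 a₁ with h3 | h3
    · exact not_nicPlanar_completeMultipartite_of_three_le h3 (by omega) (by omega) h₄ h
    · exact not_nicPlanar_completeMultipartite_of_two_le (by omega) (by omega) (by omega) h₄ h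
  · rintro (⟨h₁, rfl⟩ | ⟨rfl, rfl, rfl⟩)
    · obtain rfl : a₃ = 1 := by omega
      obtain rfl : a₄ = 1 := by omega
      exact nicPlanar_completeMultipartite_one h₁
    · obtain rfl : a₄ = 1 := by omega
      exact nicPlanar_completeMultipartite_two
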